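/- arXiv:1912.10094 — 2 statements merged into one kernel-verified Lean document; each statement's English description precedes it below -/
import Mathlib

section
/- Let M be a nonempty compact subset of ℝ^m with reach τ(M) defined via the set G of points with at least two distinct nearest points in M, and suppose M (with the subspace topology) is not a contractible topological space. Then for any contractible subset Z ⊆ ℝ^d, there do not exist a continuous surjection E : M → Z, a continuous map D : Z → ℝ^m, and ε < τ(M) with sup_{x∈M} ‖x − D(E(x))‖ ≤ ε. In other words, a compact manifold with non-contractible topology cannot be ε-faithfully represented (with ε < τ(M)) by a plain auto-encoder whose latent space is a contractible (e.g., simply connected convex) domain in ℝ^d. -/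
open scoped ENNReal

/-- A selection of nearest points of a compact set is continuous wherever nearest points are
unique. -/
theorem continuous_of_unique_nearest {X : Type*} [MetricSpace X] {M U : Set X}
    (hM : IsCompact M) (f : U → M)
    (hf : ∀ u : U, dist (u : X) (f u) = Metric.infDist (u : X) M)
    (hu : ∀ (u : U) (p : M), dist (u : X) p = Metric.infDist (u : X) M → p = f u) :
    Continuous f := by
  have : CompactSpace M := isCompact_iff_compactSpace.mp hM
  rw [continuous_iff_isClosed]
  intro C hC
  have hT : IsClosed {z : U × M | z.2 ∈ C ∧ dist (z.1 : X) z.2 = Metric.infDist (z.1 : X) M} := by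
    refine (hC.preimage continuous_snd).inter (isClosed_eq (by fun_prop) ?_)
    exact (Metric.continuous_infDist_pt M).comp (continuous_subtype_val.comp continuous_fst)
  convert isClosedMap_fst_of_compactSpace _ hT using 1
  ext u
  constructor
  · intro h
    exact ⟨(u, f u), ⟨h, hf u⟩, rfl⟩
  · rintro ⟨⟨v, p⟩, ⟨hpC, hp⟩, rfl⟩
    exact hu v p hp ▸ hpC

/-- If every point within `ε` of a compact set has a unique nearest point, then the set is a
retract of its closed `ε`-neighbourhood. -/
theorem exists_nearest_retraction {X : Type*} [MetricSpace X] {M : Set X} (hne : M.Nonempty)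
    (hM : IsCompact M) {ε : ℝ}
    (huniq : ∀ y, Metric.infDist y M ≤ ε → ∀ p ∈ M, ∀ q ∈ M,
      dist y p = Metric.infDist y M → dist y q = Metric.infDist y M → p = q) :
    ∃ r : C({y | Metric.infDist y M ≤ ε}, M),
      ∀ (x : M) (hx : Metric.infDist (x : X) M ≤ ε), r ⟨x, hx⟩ = x := by
  choose g hgM hg using fun y => hM.exists_infDist_eq_dist hne y
  have hu : ∀ (u : {y | Metric.infDist y M ≤ ε}) (p : M),
      dist (u : X) p = Metric.infDist (u : X) M → p = ⟨g u, hgM u⟩ := fun u p hp =>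
    Subtype.ext (huniq u u.2 p p.2 _ (hgM u) hp (hg u).symm)
  refine ⟨⟨fun u => ⟨g u, hgM u⟩,
    continuous_of_unique_nearest hM _ (fun u => (hg u).symm) hu⟩, fun x hx => ?_⟩
  exact (hu ⟨x, hx⟩ x (by simp [Metric.infDist_zero_of_mem x.2])).symm

/-- Let `M ⊆ ℝ^m` be nonempty compact with reach `τ(M)` defined via the set
`G` of points with at least two distinct nearest points in `M`, and suppose `M` is not
contractible.  Then for any contractible subset `Z ⊆ ℝ^d` there are no continuous surjection
`E : M → Z`, continuous `D : Z → ℝ^m`, and `ε < τ(M)` with `sup_{x∈M} ‖x − D(E x)‖ ≤ ε`. -/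
theorem no_faithful_plain_autoencoder_of_not_contractible
    {m : ℕ} (M : Set (EuclideanSpace ℝ (Fin m))) (hMne : M.Nonempty) (hMcpt : IsCompact M)
    (G : Set (EuclideanSpace ℝ (Fin m)))
    (hG : G = {y | ∃ p ∈ M, ∃ q ∈ M, p ≠ q ∧
      ‖y - p‖ = ‖y - q‖ ∧ ‖y - p‖ = Metric.infDist y M})
    (hM_not_contractible : ¬ ContractibleSpace M)
    (d : ℕ) (Z : Set (EuclideanSpace ℝ (Fin d))) (hZ : ContractibleSpace Z) :
    ¬ ∃ (E : M → Z) (D : Z → EuclideanSpace ℝ (Fin m)) (ε : ℝ),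
        Continuous E ∧ Function.Surjective E ∧ Continuous D ∧
        (∀ x : M, ‖(x : EuclideanSpace ℝ (Fin m)) - D (E x)‖ ≤ ε) ∧
        ENNReal.ofReal ε < ⨅ x ∈ M, ⨅ y ∈ G, edist x y := by
  rintro ⟨E, D, ε, hE, hsurj, hD, hclose, hε⟩
  apply hM_not_contractible
  have huniq : ∀ y, Metric.infDist y M ≤ ε → ∀ p ∈ M, ∀ q ∈ M,
      dist y p = Metric.infDist y M → dist y q = Metric.infDist y M → p = q := by
    intro y hy p hp q hq hyp hyq
    by_contra hpq
    have hyG : y ∈ G := by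
      rw [hG]
      refine ⟨p, hp, q, hq, hpq, ?_, ?_⟩ <;> simp only [← dist_eq_norm]
      · rw [hyp, hyq]
      · exact hyp
    have hle : (⨅ x ∈ M, ⨅ y ∈ G, edist x y) ≤ edist p y :=
      (iInf₂_le p hp).trans (iInf₂_le y hyG)
    refine absurd (hε.trans_le hle) (not_lt.mpr ?_)
    rw [edist_comm, edist_dist, hyp]
    exact ENNReal.ofReal_le_ofReal hy
  obtain ⟨r, hr⟩ := exists_nearest_retraction hMne hMcpt huniq
  have hseg : ∀ (t : unitInterval) (x : M), Metric.infDist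
      (AffineMap.lineMap (x : EuclideanSpace ℝ (Fin m)) (D (E x)) (t : ℝ)) M ≤ ε := by
    intro t x
    refine (Metric.infDist_le_dist_of_mem x.2).trans ?_
    rw [dist_lineMap_left, Real.norm_of_nonneg t.2.1, dist_eq_norm]
    exact (mul_le_of_le_one_left (norm_nonneg _) t.2.2).trans (hclose x)
  have hDmem : ∀ z : Z, D z ∈ {y | Metric.infDist y M ≤ ε} := by
    intro z
    obtain ⟨x, rfl⟩ := hsurj z
    simpa using hseg 1 x
  let e : C(M, Z) := ⟨E, hE⟩
  let δ : C(Z, {y | Metric.infDist y M ≤ ε}) := ⟨fun z => ⟨D z, hDmem z⟩, by fun_prop⟩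
  have hhom : (ContinuousMap.id M).Homotopic ((r.comp δ).comp e) := by
    refine ⟨⟨r.comp ⟨fun z => ⟨_, hseg z.1 z.2⟩, ?_⟩, fun x => ?_, fun x => ?_⟩⟩
    · refine Continuous.subtype_mk ?_ _
      simp only [AffineMap.lineMap_apply_module]
      fun_prop
    · simpa using hr x (by simpa using hseg 0 x)
    · simp [e, δ]
  rw [contractible_iff_id_nullhomotopic]
  obtain ⟨y, hy⟩ := ((id_nullhomotopic Z).comp_left e).comp_right (r.comp δ)
  exact ⟨y, hhom.trans hy⟩
end

section
/- Let S^d = {x ∈ ℝ^{d+1} : ‖x‖ = 1} be the unit sphere (d ≥ 1), and let 0 < ε < 1 (note the reach of the unit sphere equals 1). Then for every subset Z ⊆ ℝ^d, every continuous surjection E : S^d → Z, and every continuous map D : Z → ℝ^{d+1}, there exists x ∈ S^d with ‖x − D(E(x))‖ > ε. That is, the sphere S^d cannot be ε-faithfully represented by an auto-encoder whose latent space is a subset of ℝ^d. -/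
open MeasureTheory Metric Set Module

theorem exists_linearMap_det_one_add_eq_sum {V : Type*} [AddCommGroup V] [Module ℝ V]
    [FiniteDimensional ℝ V] (T : Finset ℝ) (hT : finrank ℝ V < T.card) :
    ∃ w : ℝ → ℝ, ∑ t ∈ T, w t = 1 ∧
      ∀ A : V →ₗ[ℝ] V, LinearMap.det (1 + A) = ∑ t ∈ T, w t * LinearMap.det (1 + t • A) := by
  classical
  have hinj : InjOn (id : ℝ → ℝ) T := fun _ _ _ _ h => h
  have hne : T.Nonempty := Finset.card_pos.mp (by omega)
  refine ⟨fun t => (Lagrange.basis T id t).eval 1, ?_, fun A => ?_⟩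
  · rw [← Polynomial.eval_finsetSum, Lagrange.sum_basis hinj hne, Polynomial.eval_one]
  · let b := Module.finBasis ℝ V
    let M := LinearMap.toMatrix b b A
    let p : Polynomial ℝ := Matrix.det ((Polynomial.X : Polynomial ℝ) • M.map Polynomial.C +
      (1 : Matrix (Fin (finrank ℝ V)) (Fin (finrank ℝ V)) ℝ).map Polynomial.C)
    have hp : ∀ t, p.eval t = LinearMap.det (1 + t • A) := by
      intro t
      rw [← LinearMap.det_toMatrix b]
      simp only [p, ← Polynomial.coe_evalRingHom, RingHom.map_det]
      congr 1
      ext i j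
      simp only [M, LinearMap.toMatrix_one, Matrix.one_apply, Polynomial.coe_evalRingHom, map_add,
        map_smul, RingHom.mapMatrix_apply, Matrix.map_apply, Matrix.add_apply, Matrix.smul_apply,
        smul_eq_mul, Polynomial.eval_mul, Polynomial.eval_X, Polynomial.eval_C]
      ring
    have hdeg : p.degree < T.card := by
      refine Polynomial.degree_le_natDegree.trans_lt ?_
      have := Polynomial.natDegree_det_X_add_C_le M 1
      rw [Fintype.card_fin] at this
      exact_mod_cast this.trans_lt hT
    have key := congrArg (Polynomial.eval 1) (Lagrange.eq_interpolate hinj hdeg)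
    rw [hp, one_smul, Lagrange.interpolate_apply, Polynomial.eval_finsetSum] at key
    rw [key]
    refine Finset.sum_congr rfl fun t _ => ?_
    simp [hp, mul_comm]

theorem LipschitzOnWith.lipschitzWith_indicator_closedBall {V W : Type*} [NormedAddCommGroup V]
    [NormedSpace ℝ V] [NormedAddCommGroup W] {g : V → W} {C : NNReal} {R : ℝ}
    (hg : LipschitzOnWith C g (closedBall 0 R)) (h0 : ∀ x ∈ sphere (0 : V) R, g x = 0) :
    LipschitzWith C ((closedBall (0 : V) R).indicator g) := by
  have cross : ∀ x ∈ closedBall (0 : V) R, ∀ y ∉ closedBall (0 : V) R,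
      ‖g x‖ ≤ C * dist x y := by
    intro x hx y hy
    rw [mem_closedBall_zero_iff] at hx hy
    obtain ⟨z, hz, hzR⟩ := (convex_segment x y).isPreconnected.intermediate_value
      (left_mem_segment ℝ x y) (right_mem_segment ℝ x y) continuous_norm.continuousOn
      (show R ∈ Icc ‖x‖ ‖y‖ from ⟨hx, (not_le.mp hy).le⟩)
    have h1 := hg.dist_le_mul x (mem_closedBall_zero_iff.2 hx) z
      (mem_closedBall_zero_iff.2 hzR.le)
    rw [h0 z (mem_sphere_zero_iff_norm.2 hzR), dist_zero_right] at h1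
    refine h1.trans (mul_le_mul_of_nonneg_left ?_ C.coe_nonneg)
    have := dist_add_dist_of_mem_segment hz
    linarith [dist_nonneg (x := z) (y := y)]
  refine LipschitzWith.of_dist_le_mul fun x y => ?_
  by_cases hx : x ∈ closedBall (0 : V) R <;> by_cases hy : y ∈ closedBall (0 : V) R
  · simpa [hx, hy] using hg.dist_le_mul x hx y hy
  · rw [indicator_of_mem hx, indicator_of_notMem hy, dist_zero_right]
    exact cross x hx y hy
  · rw [indicator_of_notMem hx, indicator_of_mem hy, dist_zero_left, dist_comm]
    exact cross y hy x hx
  · rw [indicator_of_notMem hx, indicator_of_notMem hy, dist_self]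
    positivity

theorem LipschitzWith.bijective_id_add {V : Type*} [NormedAddCommGroup V] [CompleteSpace V]
    {g : V → V} {C : NNReal}
    (hC : C < 1) (hg : LipschitzWith C g) : Function.Bijective fun x => x + g x := by
  constructor
  · intro x y hxy
    by_contra hne
    have h1 := hg.dist_le_mul x y
    have h2 : x - y = g y - g x := by
      rw [sub_eq_sub_iff_add_eq_add, add_comm (g y)]; exact hxy
    rw [dist_comm, dist_eq_norm, dist_eq_norm, ← h2] at h1
    have h3 : 0 < ‖x - y‖ := norm_pos_iff.2 (sub_ne_zero.2 hne)
    have h4 : (C : ℝ) < 1 := by exact_mod_cast hC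
    nlinarith
  · intro y
    have hc : ContractingWith C fun x => y - g x := by
      refine ⟨hC, LipschitzWith.of_dist_le_mul fun a b => ?_⟩
      simpa only [dist_sub_left] using hg.dist_le_mul a b
    refine ⟨hc.fixedPoint _, ?_⟩
    have := hc.fixedPoint_isFixedPt
    have h : y - g _ = _ := this
    exact (sub_eq_iff_eq_add.mp h).symm

theorem LipschitzOnWith.bijOn_id_add_closedBall {V : Type*} [NormedAddCommGroup V]
    [NormedSpace ℝ V] [CompleteSpace V] {g : V → V} {C : NNReal} {R : ℝ}
    (hC : C < 1) (hg : LipschitzOnWith C g (closedBall 0 R))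
    (h0 : ∀ x ∈ sphere (0 : V) R, g x = 0) :
    BijOn (fun x => x + g x) (closedBall 0 R) (closedBall 0 R) := by
  have hb := (hg.lipschitzWith_indicator_closedBall h0).bijective_id_add hC
  refine ⟨fun x hx => ?_, fun x hx y hy hxy => hb.1 ?_, fun y hy => ?_⟩
  · by_contra hn
    have := @hb.1 (x + g x) x (by simp only [indicator_of_mem hx, indicator_of_notMem hn, add_zero])
    exact hn (by simpa only [this] using hx)
  · simpa only [indicator_of_mem hx, indicator_of_mem hy] using hxy
  · obtain ⟨x, hx⟩ := hb.2 y
    have hxm : x ∈ closedBall (0 : V) R := by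
      by_contra hn
      simp only [indicator_of_notMem hn, add_zero] at hx
      exact hn (hx ▸ hy)
    exact ⟨x, hxm, by simpa only [indicator_of_mem hxm] using hx⟩

theorem ContDiff.integral_det_one_add_fderiv {V : Type*} [NormedAddCommGroup V]
    [NormedSpace ℝ V] [FiniteDimensional ℝ V] [MeasurableSpace V] [BorelSpace V]
    {g : V → V} (hg : ContDiff ℝ 1 g) {R : ℝ}
    (h0 : ∀ x ∈ sphere (0 : V) R, g x = 0) (μ : Measure V) [μ.IsAddHaarMeasure] :
    ∫ x in closedBall (0 : V) R, (1 + fderiv ℝ g x).det ∂μ = μ.real (closedBall 0 R) := by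
  have hcont : Continuous (fderiv ℝ g) := hg.continuous_fderiv one_ne_zero
  have hcomp : IsCompact (closedBall (0 : V) R) := isCompact_closedBall 0 R
  obtain ⟨C, hC⟩ := hcomp.exists_bound_of_continuousOn hcont.continuousOn
  obtain ⟨K, hK0, hCK⟩ : ∃ K : ℝ, 0 < K ∧ C ≤ K := ⟨max C 1, by positivity, le_max_left _ _⟩
  obtain ⟨η, hη, hdet⟩ : ∃ η > 0, ∀ A : V →L[ℝ] V, ‖A‖ < η → 0 < (1 + A).det := by
    have h1 : ∀ᶠ A : V →L[ℝ] V in nhds 0, 0 < (1 + A).det := by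
      have hc : Continuous fun A : V →L[ℝ] V => (1 + A).det :=
        ContinuousLinearMap.continuous_det.comp (by fun_prop)
      refine hc.continuousAt.eventually_mem (isOpen_Ioi.mem_nhds (?_ : 0 < (1 + 0 : V →L[ℝ] V).det))
      simp [ContinuousLinearMap.det]
    obtain ⟨η, hη, h⟩ := Metric.eventually_nhds_iff.1 h1
    exact ⟨η, hη, fun A hA => h (by simpa using hA)⟩
  let δ : ℝ := min η 1 / K
  have hδ : 0 < δ := by positivity
  have small : ∀ t ∈ Ioo 0 δ,
      ∫ x in closedBall (0 : V) R, (1 + t • fderiv ℝ g x).det ∂μ = μ.real (closedBall 0 R) := by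
    rintro t ⟨ht0, htδ⟩
    have htK : t * K < min η 1 := (lt_div_iff₀ hK0).1 htδ
    have hnorm : ∀ x ∈ closedBall (0 : V) R, ‖t • fderiv ℝ g x‖ ≤ t * K := fun x hx => by
      rw [norm_smul, Real.norm_of_nonneg ht0.le]
      exact mul_le_mul_of_nonneg_left ((hC x hx).trans hCK) ht0.le
    have hderiv : ∀ x, HasFDerivAt (fun x => t • g x) (t • fderiv ℝ g x) x := fun x =>
      ((hg.differentiable one_ne_zero) x).hasFDerivAt.const_smul t
    have hlip : LipschitzOnWith (Real.toNNReal (t * K)) (fun x => t • g x) (closedBall 0 R) := by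
      refine (convex_closedBall 0 R).lipschitzOnWith_of_nnnorm_fderiv_le
        (fun x _ => (hderiv x).differentiableAt) fun x hx => ?_
      rw [(hderiv x).fderiv]
      exact NNReal.le_toNNReal_of_coe_le (hnorm x hx)
    have hbij := hlip.bijOn_id_add_closedBall
      (by rw [Real.toNNReal_lt_one]; exact htK.trans_le (min_le_right _ _))
      (fun x hx => by simp [h0 x hx])
    have hchange := integral_image_eq_integral_abs_det_fderiv_smul μ hcomp.measurableSet
      (f' := fun x => 1 + t • fderiv ℝ g x)
      (fun x _ => ((hasFDerivAt_id x).add (hderiv x)).hasFDerivWithinAt) hbij.injOn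
      (fun _ => (1 : ℝ))
    have himg : (id + fun x => t • g x) '' closedBall (0 : V) R = closedBall 0 R := hbij.image_eq
    rw [himg] at hchange
    simp only [integral_const, smul_eq_mul, mul_one, measureReal_restrict_apply_univ] at hchange
    rw [hchange]
    refine setIntegral_congr_fun hcomp.measurableSet fun x hx => ?_
    exact (abs_of_pos (hdet _ ((hnorm x hx).trans_lt (htK.trans_le (min_le_left _ _))))).symm
  obtain ⟨T, hTsub, hTcard⟩ := (Ioo_infinite hδ).exists_subset_card_eq (finrank ℝ V + 1)
  obtain ⟨w, hw1, hw⟩ := exists_linearMap_det_one_add_eq_sum (V := V) T (by omega)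
  have hw' : ∀ x, (1 + fderiv ℝ g x).det = ∑ t ∈ T, w t * (1 + t • fderiv ℝ g x).det :=
    fun x => hw (fderiv ℝ g x : V →ₗ[ℝ] V)
  simp_rw [hw']
  rw [integral_finsetSum]
  · simp_rw [integral_const_mul]
    rw [Finset.sum_congr rfl fun t ht => by rw [small t (hTsub ht)], ← Finset.sum_mul, hw1, one_mul]
  · intro t _
    refine ContinuousOn.integrableOn_compact hcomp (Continuous.continuousOn ?_)
    exact continuous_const.mul (ContinuousLinearMap.continuous_det.comp (by fun_prop))

section

variable {V : Type*} [NormedAddCommGroup V] [InnerProductSpace ℝ V] [FiniteDimensional ℝ V]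

theorem exists_norm_ne_one_of_contDiff_of_eqOn_sphere {r : V → V} (hr : ContDiff ℝ 1 r)
    (hid : ∀ x ∈ sphere (0 : V) 1, r x = x) : ∃ x, ‖r x‖ ≠ 1 := by
  by_contra! hnorm
  borelize V
  let μ : Measure V := Measure.addHaar
  have hint := (hr.sub contDiff_id).integral_det_one_add_fderiv (R := 1)
    (fun x hx => by simp [hid x hx]) μ
  have hpos : 0 < μ.real (closedBall (0 : V) 1) :=
    ENNReal.toReal_pos (measure_closedBall_pos μ 0 one_pos).ne' measure_closedBall_lt_top.ne
  have hdet : ∀ x, (1 + fderiv ℝ (fun x => r x - id x) x).det = 0 := by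
    intro x
    have hd := (hr.differentiable one_ne_zero) x
    have h1 : 1 + fderiv ℝ (fun x => r x - id x) x = fderiv ℝ r x := by
      rw [fderiv_fun_sub hd differentiableAt_id, fderiv_id]
      exact add_sub_cancel _ _
    rw [h1]
    by_contra hne
    have hsurj : Function.Surjective (fderiv ℝ r x) :=
      ((fderiv ℝ r x).toContinuousLinearEquivOfDetNeZero hne).surjective
    obtain ⟨v, hv⟩ := hsurj (r x)
    have hconst : (fun y => inner ℝ (r y) (r y)) = fun _ => (1 : ℝ) := by
      ext y
      rw [real_inner_self_eq_norm_sq, hnorm, one_pow]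
    have hd2 := (hd.hasFDerivAt.inner ℝ hd.hasFDerivAt).fderiv
    rw [hconst, fderiv_fun_const] at hd2
    have := congrArg (fun L => L v) hd2
    norm_num [hv, hnorm] at this
  simp only [hdet, integral_zero] at hint
  exact hpos.ne hint

theorem exists_eq_zero_of_contDiff_of_inner_pos_on_sphere {G : V → V} (hG : ContDiff ℝ 1 G)
    (hpos : ∀ x ∈ sphere (0 : V) 1, 0 < inner ℝ x (G x)) : ∃ x, G x = 0 := by
  by_contra! hne
  have hclosed : IsClosed {x : V | x ∈ closedBall (0 : V) 1 ∧ inner ℝ x (G x) ≤ 0} :=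
    isClosed_closedBall.and (isClosed_le (continuous_id.inner hG.continuous) continuous_const)
  obtain ⟨ρ, ⟨hρ0, hρ1⟩, hsub⟩ := exists_pos_lt_subset_ball one_pos hclosed (x := 0) (by
    rintro x ⟨hx, hx'⟩
    by_contra hn
    have : x ∈ sphere (0 : V) 1 := by
      rw [mem_ball, not_lt] at hn
      exact le_antisymm hx hn
    exact absurd (hpos x this) (not_lt.2 hx'))
  let χ : ContDiffBump (0 : V) := ⟨ρ, 1, hρ0, hρ1⟩
  let H : V → V := fun x => χ x • G x + (1 - χ x) • x
  have hH1 : ∀ x : V, 1 ≤ ‖x‖ → H x = x := fun x hx => by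
    have : χ x = 0 := χ.zero_of_le_dist (by simpa using hx)
    simp [H, this]
  have hH0 : ∀ x, H x ≠ 0 := by
    intro x hx
    rcases le_or_gt 1 ‖x‖ with h1 | h1
    · rw [hH1 x h1] at hx
      simp [hx] at h1
      linarith
    rcases lt_or_ge ‖x‖ ρ with h2 | h2
    · have : χ x = 1 := χ.one_of_mem_closedBall (by simpa using h2.le)
      simp [H, this, hne] at hx
    · have hx0 : 0 < inner ℝ x (G x) := by
        by_contra hn
        have := hsub ⟨mem_closedBall_zero_iff.2 h1.le, not_lt.1 hn⟩
        rw [mem_ball_zero_iff] at this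
        linarith
      have hi : inner ℝ x (H x) = 0 := by rw [hx, inner_zero_right]
      simp only [H, inner_add_right, inner_smul_right, real_inner_self_eq_norm_sq] at hi
      have hχ0 : 0 ≤ χ x := χ.nonneg
      have hχ1 : χ x ≤ 1 := χ.le_one
      have hn : 0 < ‖x‖ ^ 2 := by have := hρ0.trans_le h2; positivity
      rcases hχ0.eq_or_lt with h | h
      · rw [← h] at hi; linarith
      · nlinarith [mul_pos h hx0, mul_nonneg (sub_nonneg.2 hχ1) hn.le]
  have hHs : ContDiff ℝ 1 H := by
    have := χ.contDiff (n := 1)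
    exact (this.smul hG).add ((contDiff_const.sub this).smul contDiff_id)
  have hr : ContDiff ℝ 1 fun x => ‖H x‖⁻¹ • H x :=
    ((hHs.norm ℝ hH0).inv fun x => norm_ne_zero_iff.2 (hH0 x)).smul hHs
  obtain ⟨x, hx⟩ := exists_norm_ne_one_of_contDiff_of_eqOn_sphere hr fun x hx => by
    rw [mem_sphere_zero_iff_norm] at hx
    simp [hH1 x hx.ge, hx]
  exact hx (by rw [norm_smul, norm_inv, norm_norm, inv_mul_cancel₀ (norm_ne_zero_iff.2 (hH0 x))])

end

theorem sphere_exists_lt_norm_sub_comp {V W : Type*} [NormedAddCommGroup V]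
    [InnerProductSpace ℝ V] [FiniteDimensional ℝ V] [NormedAddCommGroup W] [NormedSpace ℝ W]
    [FiniteDimensional ℝ W] (hdim : finrank ℝ W < finrank ℝ V) {ε : ℝ} (hε : ε < 1)
    {E : V → W} (hE : Continuous E) {D : W → V} (hD : Continuous D) :
    ∃ x ∈ sphere (0 : V) 1, ε < ‖x - D (E x)‖ := by
  by_contra! hle
  obtain ⟨δ, hδ0, hδ⟩ : ∃ δ : ℝ, 0 < δ ∧ ε + 3 * δ < 1 :=
    ⟨(1 - ε) / 4, by linarith, by linarith⟩
  obtain ⟨P, hP, hPD, -⟩ := hD.exists_contDiff_approx 1 (ε := fun _ => δ) continuous_const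
    fun _ => hδ0
  obtain ⟨c, hcP, hc⟩ := (hP.dense_compl_range_of_finrank_lt_finrank hdim).exists_dist_lt 0 hδ0
  have hunif : ∃ η > 0, ∀ x ∈ sphere (0 : V) 1, ∀ y, dist y (E x) < η →
      dist (P y) (P (E x)) < δ := by
    obtain ⟨η, hη, h⟩ := Metric.mem_uniformity_dist.1
      (((isCompact_sphere (0 : V) 1).image hE).uniformContinuousAt_of_continuousAt P
        (fun _ _ => hP.continuous.continuousAt) (dist_mem_uniformity hδ0))
    refine ⟨η, hη, fun x hx y hy => ?_⟩
    rw [dist_comm] at hy ⊢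
    exact h hy (mem_image_of_mem E hx)
  obtain ⟨η, hη, hPη⟩ := hunif
  obtain ⟨Q, hQ, hQE, -⟩ := hE.exists_contDiff_approx 1 (ε := fun _ => η) continuous_const
    fun _ => hη
  obtain ⟨x, hx⟩ := exists_eq_zero_of_contDiff_of_inner_pos_on_sphere
    ((hP.comp hQ).sub (contDiff_const (c := c))) fun x hx => by
      have hx1 : ‖x‖ = 1 := mem_sphere_zero_iff_norm.1 hx
      have h1 := hle x hx
      have h2 := hPD (E x)
      have h3 := hPη x hx (Q x) (hQE x)
      have h4 : dist x (P (Q x) - c) < 1 := by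
        have h5 : dist (P (Q x)) (P (Q x) - c) < δ := by
          simpa [dist_comm] using hc
        rw [← dist_eq_norm] at h1
        rw [dist_comm] at h2 h3
        linarith [dist_triangle4 x (D (E x)) (P (E x)) (P (Q x)),
          dist_triangle x (P (Q x)) (P (Q x) - c)]
      have h6 : inner ℝ x (x - (P (Q x) - c)) < 1 := by
        refine (real_inner_le_norm _ _).trans_lt ?_
        rwa [hx1, one_mul, ← dist_eq_norm]
      rw [inner_sub_right, real_inner_self_eq_norm_sq, hx1] at h6
      simp only [Function.comp]
      linarith
  exact hcP ⟨Q x, sub_eq_zero.1 hx⟩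

/-- Let `S^d ⊆ ℝ^{d+1}` be the unit sphere (`d ≥ 1`) and `0 < ε < 1` (the
reach of the unit sphere is `1`).  For every subset `Z ⊆ ℝ^d`, every continuous surjection
`E : S^d → Z`, and every continuous `D : Z → ℝ^{d+1}`, there is `x ∈ S^d` with
`‖x − D(E x)‖ > ε`; i.e. the sphere admits no `ε`-faithful auto-encoder with latent space
contained in `ℝ^d`. -/
theorem sphere_no_faithful_flat_autoencoder
    (d : ℕ) (hd : 1 ≤ d) (ε : ℝ) (hε₀ : 0 < ε) (hε₁ : ε < 1)
    (Z : Set (EuclideanSpace ℝ (Fin d)))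
    (E : Metric.sphere (0 : EuclideanSpace ℝ (Fin (d + 1))) 1 → Z)
    (hEcont : Continuous E) (hEsurj : Function.Surjective E)
    (D : Z → EuclideanSpace ℝ (Fin (d + 1))) (hDcont : Continuous D) :
    ∃ x : Metric.sphere (0 : EuclideanSpace ℝ (Fin (d + 1))) 1,
      ε < ‖(x : EuclideanSpace ℝ (Fin (d + 1))) - D (E x)‖ := by
  have hZ : IsCompact Z := by
    have := isCompact_range hEcont
    rw [hEsurj.range_eq] at this
    exact isCompact_iff_isCompact_univ.2 this
  obtain ⟨D', hD'⟩ := ContinuousMap.exists_restrict_eq hZ.isClosed ⟨D, hDcont⟩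
  obtain ⟨E', hE'⟩ := ContinuousMap.exists_restrict_eq
    (isClosed_sphere (x := (0 : EuclideanSpace ℝ (Fin (d + 1)))) (ε := 1))
    ⟨fun x => (E x : EuclideanSpace ℝ (Fin d)), continuous_subtype_val.comp hEcont⟩
  obtain ⟨x, hx, h⟩ := sphere_exists_lt_norm_sub_comp (by simp) hε₁ E'.continuous D'.continuous
  have h1 : E' x = E ⟨x, hx⟩ := DFunLike.congr_fun hE' ⟨x, hx⟩
  have h2 : D' (E ⟨x, hx⟩) = D (E ⟨x, hx⟩) := DFunLike.congr_fun hD' (E ⟨x, hx⟩)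
  exact ⟨⟨x, hx⟩, by rw [h1, h2] at h; exact h⟩
end
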